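/- arXiv:2405.09400 — 6 statements merged into one kernel-verified Lean document; each statement's English description precedes it below -/
import Mathlib

section
/- The entropic optimal transport problem min_{π∈Π(μ,ν)} ⟨c,π⟩ + ε·KL(π|μ⊗ν) admits a unique minimizer π* ∈ Π(μ,ν). -/
open MeasureTheory Filter Topology
open scoped ENNReal

noncomputable section

/-- `π` is a coupling (transport plan) between `μ` and `ν`. -/
def IsCoupling {X Y : Type*} [MeasurableSpace X] [MeasurableSpace Y]
    (μ : Measure X) (ν : Measure Y) (π : Measure (X × Y)) : Prop :=
  π.map Prod.fst = μ ∧ π.map Prod.snd = ν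

/-- `φ(s) = s·log s − s + 1`; note `Real.log 0 = 0`, so `phiKL 0 = 1` as required. -/
def phiKL (s : ℝ) : ℝ := s * Real.log s - s + 1

/-- Kullback–Leibler divergence `KL(ρ|σ) = ∫ φ(dρ/dσ) dσ` if `ρ ≪ σ`, and `+∞` otherwise. -/
def KL {Z : Type*} [MeasurableSpace Z] (ρ σ : Measure Z) : ℝ≥0∞ :=
  letI := Classical.propDecidable (ρ ≪ σ)
  if ρ ≪ σ then ∫⁻ z, ENNReal.ofReal (phiKL ((ρ.rnDeriv σ) z).toReal) ∂σ else ⊤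

/-- The entropic optimal transport objective `⟨c,π⟩ + ε·KL(π|μ⊗ν)`, valued in `EReal`. -/
def EOT {X Y : Type*} [MeasurableSpace X] [MeasurableSpace Y]
    (c : X × Y → ℝ) (ε : ℝ) (μ : Measure X) (ν : Measure Y)
    (π : Measure (X × Y)) : EReal :=
  ((∫ p, c p ∂π : ℝ) : EReal) + (ε : EReal) * ((KL π (μ.prod ν) : ℝ≥0∞) : EReal)

/-- A function on a complete metric space with closed sublevel sets which is uniformly convex in the
sense of a quadratic approximate-midpoint inequality has exactly one minimizer on `K`. -/
theorem exists_unique_minimizer_of_midpoint_le {E : Type*} [MetricSpace E] [CompleteSpace E]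
    {K : Set E} {J : E → ℝ≥0∞} (hclosed : ∀ t, IsClosed {f | f ∈ K ∧ J f ≤ t})
    (hfin : ∃ f ∈ K, J f ≠ ⊤) {k : ℝ} (hk : 0 < k)
    (hmid : ∀ f ∈ K, ∀ g ∈ K, ∃ h ∈ K, 2 * J h + ENNReal.ofReal (k * dist f g ^ 2) ≤ J f + J g) :
    ∃ f ∈ K, J f ≠ ⊤ ∧ ∀ g ∈ K, J f ≤ J g ∧ (J g ≤ J f → g = f) := by
  set m : ℝ≥0∞ := ⨅ f ∈ K, J f with hm
  have hm_le : ∀ f ∈ K, m ≤ J f := fun f hf => iInf₂_le f hf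
  have hm_top : m ≠ ⊤ := by
    obtain ⟨f, hf, hJ⟩ := hfin
    exact ne_top_of_le_ne_top hJ (hm_le f hf)
  have key : ∀ f ∈ K, ∀ g ∈ K, ∀ r : ℝ, 0 ≤ r → J f ≤ m + ENNReal.ofReal (k * r ^ 2 / 2) →
      J g ≤ m + ENNReal.ofReal (k * r ^ 2 / 2) → dist f g ≤ r := by
    intro f hf g hg r hr hJf hJg
    obtain ⟨h, hh, hle⟩ := hmid f hf g hg
    have h1 : 2 * m + ENNReal.ofReal (k * dist f g ^ 2) ≤ 2 * m + ENNReal.ofReal (k * r ^ 2) := by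
      calc 2 * m + ENNReal.ofReal (k * dist f g ^ 2)
          ≤ 2 * J h + ENNReal.ofReal (k * dist f g ^ 2) := by gcongr; exact hm_le h hh
        _ ≤ J f + J g := hle
        _ ≤ (m + ENNReal.ofReal (k * r ^ 2 / 2)) + (m + ENNReal.ofReal (k * r ^ 2 / 2)) := by gcongr
        _ = 2 * m + (ENNReal.ofReal (k * r ^ 2 / 2) + ENNReal.ofReal (k * r ^ 2 / 2)) := by ring
        _ = 2 * m + ENNReal.ofReal (k * r ^ 2) := by
          rw [← ENNReal.ofReal_add (by positivity) (by positivity), add_halves]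
    have h2 := (ENNReal.add_le_add_iff_left (ENNReal.mul_ne_top (by simp) hm_top)).1 h1
    rw [ENNReal.ofReal_le_ofReal_iff (by positivity)] at h2
    exact (sq_le_sq₀ dist_nonneg hr).1 (le_of_mul_le_mul_left h2 hk)
  have hseq : ∀ n : ℕ, ∃ f ∈ K, J f ≤ m + ENNReal.ofReal (k * ((1 / 2 : ℝ) ^ n) ^ 2 / 2) := by
    intro n
    have hlt : m < m + ENNReal.ofReal (k * ((1 / 2 : ℝ) ^ n) ^ 2 / 2) :=
      ENNReal.lt_add_right hm_top (by simp only [ne_eq, ENNReal.ofReal_eq_zero, not_le]; positivity)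
    rw [hm] at hlt
    obtain ⟨f, hlt⟩ := iInf_lt_iff.1 hlt
    obtain ⟨hf, hlt⟩ := iInf_lt_iff.1 hlt
    exact ⟨f, hf, hlt.le⟩
  choose u huK huJ using hseq
  have hmono : ∀ n N, N ≤ n → J (u n) ≤ m + ENNReal.ofReal (k * ((1 / 2 : ℝ) ^ N) ^ 2 / 2) := by
    intro n N hNn
    refine (huJ n).trans ?_
    have : (1 / 2 : ℝ) ^ n ≤ (1 / 2 : ℝ) ^ N :=
      pow_le_pow_of_le_one (by norm_num) (by norm_num) hNn
    gcongr
  have hcau : CauchySeq u := cauchySeq_of_le_tendsto_0 (fun n => (1 / 2 : ℝ) ^ n)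
    (fun n p N hn hp => key _ (huK n) _ (huK p) _ (by positivity) (hmono n N hn) (hmono p N hp))
    (tendsto_pow_atTop_nhds_zero_of_lt_one (by norm_num) (by norm_num))
  obtain ⟨f, hf⟩ := cauchySeq_tendsto_of_complete hcau
  have hmem : ∀ N : ℕ, f ∈ K ∧ J f ≤ m + ENNReal.ofReal (k * ((1 / 2 : ℝ) ^ N) ^ 2 / 2) := fun N =>
    (hclosed _).mem_of_tendsto hf
      (eventually_atTop.2 ⟨N, fun n hn => ⟨huK n, hmono n N hn⟩⟩)
  have hlim : Tendsto (fun N : ℕ => m + ENNReal.ofReal (k * ((1 / 2 : ℝ) ^ N) ^ 2 / 2)) atTop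
      (𝓝 m) := by
    have h0 : Tendsto (fun N : ℕ => k * ((1 / 2 : ℝ) ^ N) ^ 2 / 2) atTop (𝓝 (k * 0 ^ 2 / 2)) :=
      (((tendsto_pow_atTop_nhds_zero_of_lt_one (by norm_num) (by norm_num)).pow 2).const_mul
        k).div_const 2
    simpa using (ENNReal.tendsto_ofReal h0).const_add m
  have hJf : J f ≤ m := ge_of_tendsto' hlim fun N => (hmem N).2
  refine ⟨f, (hmem 0).1, ne_top_of_le_ne_top hm_top hJf, fun g hg =>
    ⟨hJf.trans (hm_le g hg), fun hgf => ?_⟩⟩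
  exact dist_le_zero.1 (key g hg f (hmem 0).1 0 le_rfl (by simpa using hgf.trans hJf)
    (by simpa using hJf))

lemma phiKL_eq_klFun : phiKL = InformationTheory.klFun := by
  ext s
  simp only [phiKL, InformationTheory.klFun]
  ring

lemma continuous_phiKL : Continuous phiKL :=
  phiKL_eq_klFun ▸ InformationTheory.continuous_klFun

lemma phiKL_nonneg {s : ℝ} (hs : 0 ≤ s) : 0 ≤ phiKL s :=
  phiKL_eq_klFun ▸ InformationTheory.klFun_nonneg hs

lemma two_mul_sub_sqrt_mul_sqrt_le {a m : ℝ} (ha : 0 ≤ a) (hm : 0 < m) :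
    2 * a - 2 * (√a * √m) ≤ a * Real.log a - a * Real.log m := by
  rcases ha.eq_or_lt with rfl | ha
  · simp
  have hsa := Real.sqrt_pos.2 ha
  have h := Real.log_le_sub_one_of_pos (div_pos (Real.sqrt_pos.2 hm) hsa)
  rw [Real.log_div (Real.sqrt_pos.2 hm).ne' hsa.ne', Real.log_sqrt hm.le, Real.log_sqrt ha.le] at h
  have h2 := mul_le_mul_of_nonneg_left h ha.le
  have h3 : a * (√m / √a - 1) = √a * √m - a := by
    rw [mul_sub, mul_one, sub_left_inj, ← mul_div_assoc, div_eq_iff hsa.ne']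
    linear_combination -√m * Real.mul_self_sqrt ha.le
  linarith

/-- Uniform convexity of `φ` along midpoints, measured in the Hellinger distance. -/
lemma phiKL_midpoint_le {a b : ℝ} (ha : 0 ≤ a) (hb : 0 ≤ b) :
    2 * phiKL ((a + b) / 2) + (√a - √b) ^ 2 / 2 ≤ phiKL a + phiKL b := by
  rcases (add_nonneg ha hb).eq_or_lt with h | h
  · obtain rfl : a = 0 := by linarith
    obtain rfl : b = 0 := by linarith
    simp [phiKL]; norm_num
  have hm : 0 < (a + b) / 2 := by linarith
  have h1 := two_mul_sub_sqrt_mul_sqrt_le ha hm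
  have h2 := two_mul_sub_sqrt_mul_sqrt_le hb hm
  have h3 : 2 * (√((a + b) / 2)) ^ 2 = √a ^ 2 + √b ^ 2 := by
    rw [Real.sq_sqrt hm.le, Real.sq_sqrt ha, Real.sq_sqrt hb]; ring
  have h4 := Real.sq_sqrt ha
  have h5 := Real.sq_sqrt hb
  simp only [phiKL]
  nlinarith [sq_nonneg (2 * √((a + b) / 2) - √a - √b)]

/-- A linearization of `phiKL_midpoint_le` in terms of `|a - b|`. -/
lemma phiKL_midpoint_abs_le {a b : ℝ} (ha : 0 ≤ a) (hb : 0 ≤ b) {l : ℝ} (hl : 0 ≤ l) :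
    2 * phiKL ((a + b) / 2) + l * |a - b| ≤ phiKL a + phiKL b + l ^ 2 * (a + b) := by
  have h := phiKL_midpoint_le ha hb
  have h4 := Real.sq_sqrt ha
  have h5 := Real.sq_sqrt hb
  have h6 : |a - b| = |√a - √b| * (√a + √b) := by
    rw [← abs_of_nonneg (add_nonneg (Real.sqrt_nonneg a) (Real.sqrt_nonneg b)), ← abs_mul]
    congr 1
    nlinarith
  have h7 := sq_abs (√a - √b)
  nlinarith [sq_nonneg (|√a - √b| - l * (√a + √b)), sq_nonneg (l * (√a - √b))]

/-- The entropic objective of the measure with density `f` with respect to `σ`. -/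
def densityEnergy {Z : Type*} [MeasurableSpace Z] (σ : Measure Z) (c : Z → ℝ) (ε : ℝ) (f : Z → ℝ) :
    ℝ≥0∞ :=
  ∫⁻ z, ENNReal.ofReal (c z * f z + ε * phiKL (f z)) ∂σ

section DensityEnergy

variable {Z : Type*} [MeasurableSpace Z] {σ : Measure Z} {c : Z → ℝ} {ε : ℝ}

lemma aemeasurable_densityEnergy_integrand (hc : Measurable c) {f : Z → ℝ} (hf : AEMeasurable f σ) :
    AEMeasurable (fun z => ENNReal.ofReal (c z * f z + ε * phiKL (f z))) σ :=
  ((hc.aemeasurable.mul hf).add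
    ((continuous_phiKL.measurable.comp_aemeasurable hf).const_mul ε)).ennreal_ofReal

lemma isClosed_densityEnergy_le (hc : Measurable c) (t : ℝ≥0∞) :
    IsClosed {f : Lp ℝ 1 σ | densityEnergy σ c ε f ≤ t} := by
  refine IsSeqClosed.isClosed fun u f hu hlim => ?_
  obtain ⟨ns, -, hns⟩ := (tendstoInMeasure_of_tendsto_Lp hlim).exists_seq_tendsto_ae
  calc densityEnergy σ c ε f
      ≤ ∫⁻ z, liminf (fun n => ENNReal.ofReal
          (c z * u (ns n) z + ε * phiKL (u (ns n) z))) atTop ∂σ := by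
        refine lintegral_mono_ae ?_
        filter_upwards [hns] with z hz
        refine le_of_eq (Tendsto.liminf_eq ?_).symm
        exact ENNReal.tendsto_ofReal ((hz.const_mul _).add
          (((continuous_phiKL.tendsto _).comp hz).const_mul _))
    _ ≤ liminf (fun n => densityEnergy σ c ε (u (ns n))) atTop :=
        lintegral_liminf_le' fun n => aemeasurable_densityEnergy_integrand hc
          (Lp.aestronglyMeasurable _).aemeasurable
    _ ≤ t := by
        refine (liminf_le_liminf (Eventually.of_forall fun n => hu (ns n))).trans ?_
        simp

/-- Uniform convexity of the entropic objective in `L¹`, a form of Pinsker's inequality. -/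
lemma densityEnergy_midpoint_le (hc : Measurable c) (hc0 : ∀ z, 0 ≤ c z) (hε : 0 < ε)
    {f g : Lp ℝ 1 σ} (hf : 0 ≤ f) (hg : 0 ≤ g) (hf1 : ∫ z, f z ∂σ = 1) (hg1 : ∫ z, g z ∂σ = 1) :
    2 * densityEnergy σ c ε ((1 / 2 : ℝ) • (f + g) : Lp ℝ 1 σ) +
      ENNReal.ofReal (ε / 8 * dist f g ^ 2) ≤ densityEnergy σ c ε f + densityEnergy σ c ε g := by
  have hfi := L1.integrable_coeFn f
  have hgi := L1.integrable_coeFn g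
  have hd : dist f g = ∫ z, |f z - g z| ∂σ := by
    rw [L1.dist_eq_integral_dist]; rfl
  have hf0 := (Lp.coeFn_nonneg f).2 hf
  have hg0 := (Lp.coeFn_nonneg g).2 hg
  obtain ⟨l, hl⟩ : ∃ l, l = dist f g / 4 := ⟨_, rfl⟩
  have hl0 : 0 ≤ l := by rw [hl]; positivity
  have hm := aemeasurable_densityEnergy_integrand (ε := ε) hc
    (Lp.aestronglyMeasurable ((1 / 2 : ℝ) • (f + g))).aemeasurable
  have hmf := aemeasurable_densityEnergy_integrand (ε := ε) hc
    (Lp.aestronglyMeasurable f).aemeasurable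
  have hmg := aemeasurable_densityEnergy_integrand (ε := ε) hc
    (Lp.aestronglyMeasurable g).aemeasurable
  have hL : ∫⁻ z, ENNReal.ofReal (ε * l * |f z - g z|) ∂σ
      = ENNReal.ofReal (ε / 8 * dist f g ^ 2) + ENNReal.ofReal (ε / 8 * dist f g ^ 2) := by
    have hi : Integrable (fun z => ε * l * |f z - g z|) σ := (hfi.sub hgi).abs.const_mul (ε * l)
    rw [← ofReal_integral_eq_lintegral_ofReal hi (ae_of_all _ fun z => by dsimp; positivity),
      integral_const_mul, ← ENNReal.ofReal_add (by positivity) (by positivity), ← hd, hl]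
    congr 1
    ring
  have hR : ∫⁻ z, ENNReal.ofReal (ε * l ^ 2 * (f z + g z)) ∂σ
      = ENNReal.ofReal (ε / 8 * dist f g ^ 2) := by
    have hi : Integrable (fun z => ε * l ^ 2 * (f z + g z)) σ := (hfi.add hgi).const_mul (ε * l ^ 2)
    rw [← ofReal_integral_eq_lintegral_ofReal hi ?_, integral_const_mul]
    · rw [integral_add hfi hgi, hf1, hg1, hl]
      congr 1
      ring
    · filter_upwards [hf0, hg0] with z h1 h2
      have := add_nonneg h1 h2
      simp only [Pi.zero_apply] at this ⊢
      positivity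
  have hmain : 2 * densityEnergy σ c ε ((1 / 2 : ℝ) • (f + g) : Lp ℝ 1 σ) +
      ∫⁻ z, ENNReal.ofReal (ε * l * |f z - g z|) ∂σ ≤
      densityEnergy σ c ε f + densityEnergy σ c ε g +
      ∫⁻ z, ENNReal.ofReal (ε * l ^ 2 * (f z + g z)) ∂σ := by
    simp only [densityEnergy]
    rw [← lintegral_const_mul'' _ hm, ← lintegral_add_left' (hm.const_mul 2),
      ← lintegral_add_left' hmf]
    refine le_of_le_of_eq ?_ (lintegral_add_left' (hmf.add hmg) _)
    refine lintegral_mono_ae ?_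
    filter_upwards [hf0, hg0, Lp.coeFn_smul (1 / 2 : ℝ) (f + g), Lp.coeFn_add f g]
      with z h1 h2 h3 h4
    have h5 : ((1 / 2 : ℝ) • (f + g) : Lp ℝ 1 σ) z = (f z + g z) / 2 := by
      rw [h3, Pi.smul_apply, h4, Pi.add_apply, smul_eq_mul]; ring
    simp only [Pi.zero_apply] at h1 h2
    rw [h5, Pi.add_apply]
    have hcz := hc0 z
    have p1 := phiKL_nonneg h1
    have p2 := phiKL_nonneg h2
    have p3 : 0 ≤ phiKL ((f z + g z) / 2) := phiKL_nonneg (by positivity)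
    have key := mul_le_mul_of_nonneg_left (phiKL_midpoint_abs_le h1 h2 hl0) hε.le
    rw [← ENNReal.ofReal_add (by positivity) (by positivity),
      ← ENNReal.ofReal_add (by positivity) (by positivity),
      ← ENNReal.ofReal_ofNat 2, ← ENNReal.ofReal_mul (by norm_num),
      ← ENNReal.ofReal_add (by positivity) (by positivity)]
    refine ENNReal.ofReal_le_ofReal ?_
    linarith
  rw [hL, hR, ← add_assoc] at hmain
  exact (ENNReal.add_le_add_iff_right ENNReal.ofReal_ne_top).1 hmain

end DensityEnergy

section Coupling

variable {X Y : Type*} [MeasurableSpace X] [MeasurableSpace Y] {μ : Measure X} {ν : Measure Y}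

/-- The densities with respect to `μ ⊗ ν` of the absolutely continuous couplings. -/
def couplingDensities (μ : Measure X) (ν : Measure Y) : Set (Lp ℝ 1 (μ.prod ν)) :=
  {f | 0 ≤ f ∧
    (∀ A, MeasurableSet A → ∫ z in Prod.fst ⁻¹' A, f z ∂(μ.prod ν) = μ.real A) ∧
    ∀ B, MeasurableSet B → ∫ z in Prod.snd ⁻¹' B, f z ∂(μ.prod ν) = ν.real B}

lemma isClosed_couplingDensities : IsClosed (couplingDensities μ ν) := by
  simp only [couplingDensities, Set.ofPred_and, Set.ofPred_forall]
  refine isClosed_Ici.inter (IsClosed.inter ?_ ?_) <;>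
  exact isClosed_iInter fun A => isClosed_iInter fun _ =>
    isClosed_eq (continuous_setIntegral _) continuous_const

lemma midpoint_mem_couplingDensities {f g : Lp ℝ 1 (μ.prod ν)} (hf : f ∈ couplingDensities μ ν)
    (hg : g ∈ couplingDensities μ ν) : (1 / 2 : ℝ) • (f + g) ∈ couplingDensities μ ν := by
  have hint : ∀ s, ∫ z in s, ((1 / 2 : ℝ) • (f + g) : Lp ℝ 1 (μ.prod ν)) z ∂(μ.prod ν)
      = 1 / 2 * (∫ z in s, f z ∂(μ.prod ν) + ∫ z in s, g z ∂(μ.prod ν)) := by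
    intro s
    rw [← integral_add (L1.integrable_coeFn f).integrableOn (L1.integrable_coeFn g).integrableOn,
      ← integral_const_mul]
    refine integral_congr_ae (ae_restrict_of_ae ?_)
    filter_upwards [Lp.coeFn_smul (1 / 2 : ℝ) (f + g), Lp.coeFn_add f g] with z h3 h4
    rw [h3, Pi.smul_apply, h4, Pi.add_apply, smul_eq_mul]
  refine ⟨?_, fun A hA => ?_, fun B hB => ?_⟩
  · rw [← Lp.coeFn_nonneg]
    filter_upwards [(Lp.coeFn_nonneg f).2 hf.1, (Lp.coeFn_nonneg g).2 hg.1,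
      Lp.coeFn_smul (1 / 2 : ℝ) (f + g), Lp.coeFn_add f g] with z h1 h2 h3 h4
    rw [h3, Pi.smul_apply, h4, Pi.add_apply, smul_eq_mul]
    have := add_nonneg h1 h2
    simp only [Pi.zero_apply] at this ⊢
    positivity
  · rw [hint, hf.2.1 A hA, hg.2.1 A hA]; ring
  · rw [hint, hf.2.2 B hB, hg.2.2 B hB]; ring

lemma integral_eq_one_of_mem_couplingDensities [IsProbabilityMeasure μ] {f : Lp ℝ 1 (μ.prod ν)}
    (hf : f ∈ couplingDensities μ ν) : ∫ z, f z ∂(μ.prod ν) = 1 := by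
  simpa using hf.2.1 Set.univ MeasurableSet.univ

/-- The measure with density `f` with respect to `σ`. -/
def densityMeasure {Z : Type*} [MeasurableSpace Z] {σ : Measure Z} (f : Lp ℝ 1 σ) : Measure Z :=
  σ.withDensity fun z => ENNReal.ofReal (f z)

lemma densityMeasure_apply {Z : Type*} [MeasurableSpace Z] {σ : Measure Z} {f : Lp ℝ 1 σ}
    (hf : 0 ≤ f) {s : Set Z} (hs : MeasurableSet s) :
    densityMeasure f s = ENNReal.ofReal (∫ z in s, f z ∂σ) := by
  rw [densityMeasure, withDensity_apply _ hs, ofReal_integral_eq_lintegral_ofReal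
    (L1.integrable_coeFn f).integrableOn (ae_restrict_of_ae ((Lp.coeFn_nonneg f).2 hf))]

lemma isCoupling_densityMeasure [IsFiniteMeasure μ] [IsFiniteMeasure ν] {f : Lp ℝ 1 (μ.prod ν)}
    (hf : f ∈ couplingDensities μ ν) : IsCoupling μ ν (densityMeasure f) := by
  constructor
  · ext A hA
    rw [Measure.map_apply measurable_fst hA, densityMeasure_apply hf.1 (measurable_fst hA),
      hf.2.1 A hA, ofReal_measureReal]
  · ext B hB
    rw [Measure.map_apply measurable_snd hB, densityMeasure_apply hf.1 (measurable_snd hB),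
      hf.2.2 B hB, ofReal_measureReal]

lemma IsCoupling.isProbabilityMeasure [IsProbabilityMeasure μ] {π : Measure (X × Y)}
    (hπ : IsCoupling μ ν π) : IsProbabilityMeasure π :=
  ⟨by rw [← Set.preimage_univ (f := Prod.fst), ← Measure.map_apply measurable_fst .univ, hπ.1,
    measure_univ]⟩

lemma IsCoupling.exists_density [IsProbabilityMeasure μ] [IsProbabilityMeasure ν]
    {π : Measure (X × Y)} (hπ : IsCoupling μ ν π) (hac : π ≪ μ.prod ν) :
    ∃ f ∈ couplingDensities μ ν, densityMeasure f = π := by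
  have := hπ.isProbabilityMeasure
  have hint : Integrable (fun z => (π.rnDeriv (μ.prod ν) z).toReal) (μ.prod ν) :=
    Measure.integrable_toReal_rnDeriv
  have hae := hint.coeFn_toL1
  refine ⟨hint.toL1 _, ⟨?_, fun A hA => ?_, fun B hB => ?_⟩, ?_⟩
  · rw [← Lp.coeFn_nonneg]
    filter_upwards [hae] with z hz
    rw [hz]
    exact ENNReal.toReal_nonneg
  · rw [integral_congr_ae (ae_restrict_of_ae hae), Measure.setIntegral_toReal_rnDeriv hac,
      ← map_measureReal_apply measurable_fst hA, hπ.1]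
  · rw [integral_congr_ae (ae_restrict_of_ae hae), Measure.setIntegral_toReal_rnDeriv hac,
      ← map_measureReal_apply measurable_snd hB, hπ.2]
  · conv_rhs => rw [← Measure.withDensity_rnDeriv_eq _ _ hac]
    refine withDensity_congr_ae ?_
    filter_upwards [hae, Measure.rnDeriv_lt_top π (μ.prod ν)] with z hz hlt
    rw [hz, ENNReal.ofReal_toReal hlt.ne]

lemma isCoupling_prod [IsProbabilityMeasure μ] [IsProbabilityMeasure ν] :
    IsCoupling μ ν (μ.prod ν) := by
  constructor
  · simp [Measure.map_fst_prod]
  · simp [Measure.map_snd_prod]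

variable {c : X × Y → ℝ} {ε : ℝ}

lemma EOT_densityMeasure [IsProbabilityMeasure μ] [IsProbabilityMeasure ν] (hc : Measurable c)
    (hc0 : ∀ p, 0 ≤ c p) {M : ℝ} (hcM : ∀ p, c p ≤ M) (hε : 0 < ε) {f : Lp ℝ 1 (μ.prod ν)}
    (hf : f ∈ couplingDensities μ ν) :
    EOT c ε μ ν (densityMeasure f) = (densityEnergy (μ.prod ν) c ε f : EReal) := by
  have := (isCoupling_densityMeasure hf).isProbabilityMeasure
  have hac : densityMeasure f ≪ μ.prod ν := withDensity_absolutelyContinuous _ _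
  have hfm : AEMeasurable f (μ.prod ν) := (Lp.aestronglyMeasurable f).aemeasurable
  have hf0 := (Lp.coeFn_nonneg f).2 hf.1
  have hci : Integrable c (densityMeasure f) :=
    Integrable.of_bound hc.aestronglyMeasurable M
      (ae_of_all _ fun p => by rw [Real.norm_of_nonneg (hc0 p)]; exact hcM p)
  have hcost : ENNReal.ofReal (∫ p, c p ∂densityMeasure f)
      = ∫⁻ z, ENNReal.ofReal (c z * f z) ∂(μ.prod ν) := by
    rw [ofReal_integral_eq_lintegral_ofReal hci (ae_of_all _ hc0), densityMeasure,
      lintegral_withDensity_eq_lintegral_mul₀ hfm.ennreal_ofReal hc.ennreal_ofReal.aemeasurable]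
    refine lintegral_congr fun z => ?_
    rw [Pi.mul_apply, mul_comm, ENNReal.ofReal_mul (hc0 z)]
  have hKL : KL (densityMeasure f) (μ.prod ν)
      = ∫⁻ z, ENNReal.ofReal (phiKL (f z)) ∂(μ.prod ν) := by
    rw [KL, if_pos hac]
    refine lintegral_congr_ae ?_
    filter_upwards [hf0, Measure.rnDeriv_withDensity₀ (μ.prod ν) hfm.ennreal_ofReal] with z h1 h2
    rw [densityMeasure, h2, ENNReal.toReal_ofReal h1]
  have hsum : densityEnergy (μ.prod ν) c ε f = ENNReal.ofReal (∫ p, c p ∂densityMeasure f)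
      + ENNReal.ofReal ε * KL (densityMeasure f) (μ.prod ν) := by
    have hphi : AEMeasurable (fun z => ENNReal.ofReal (phiKL (f z))) (μ.prod ν) :=
      (continuous_phiKL.measurable.comp_aemeasurable hfm).ennreal_ofReal
    rw [hcost, hKL, ← lintegral_const_mul'' _ hphi]
    refine Eq.trans (lintegral_congr_ae ?_)
      (lintegral_add_left' (hc.aemeasurable.mul hfm).ennreal_ofReal _)
    filter_upwards [hf0] with z h1
    simp only [Pi.zero_apply] at h1
    have h2 := phiKL_nonneg h1
    have h3 := hc0 z
    rw [ENNReal.ofReal_add (by positivity) (by positivity), ENNReal.ofReal_mul hε.le,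
      Pi.mul_apply]
  rw [hsum, EReal.coe_ennreal_add, EReal.coe_ennreal_mul, EReal.coe_ennreal_ofReal,
    EReal.coe_ennreal_ofReal, max_eq_left (integral_nonneg hc0), max_eq_left hε.le, EOT]

lemma EOT_eq_top (hε : 0 < ε) {π : Measure (X × Y)} (hac : ¬ π ≪ μ.prod ν) :
    EOT c ε μ ν π = ⊤ := by
  rw [EOT, KL, if_neg hac, EReal.coe_ennreal_top, EReal.coe_mul_top_of_pos hε, EReal.coe_add_top]

lemma EOT_prod_lt_top [IsProbabilityMeasure μ] [IsProbabilityMeasure ν] :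
    EOT c ε μ ν (μ.prod ν) < ⊤ := by
  have hKL : KL (μ.prod ν) (μ.prod ν) = 0 := by
    rw [KL, if_pos Measure.AbsolutelyContinuous.rfl,
      lintegral_congr_ae (g := fun _ => 0), lintegral_zero]
    filter_upwards [Measure.rnDeriv_self (μ.prod ν)] with z hz
    simp [hz, phiKL]
  rw [EOT, hKL, EReal.coe_ennreal_zero, mul_zero, add_zero]
  exact EReal.coe_lt_top _

end Coupling

/-- the entropic optimal transport problem admits a unique minimizer. -/
theorem entropic_OT_exists_unique_minimizer
    {X Y : Type*} [MetricSpace X] [CompactSpace X] [MeasurableSpace X] [BorelSpace X]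
    [MetricSpace Y] [CompactSpace Y] [MeasurableSpace Y] [BorelSpace Y]
    (μ : Measure X) (ν : Measure Y) [IsProbabilityMeasure μ] [IsProbabilityMeasure ν]
    (c : X × Y → ℝ) (hc_lsc : LowerSemicontinuous c) (hc_nonneg : ∀ p, 0 ≤ c p)
    (M : ℝ) (hc_bdd : ∀ p, c p ≤ M) (ε : ℝ) (hε : 0 < ε) :
    ∃! πstar : Measure (X × Y), IsCoupling μ ν πstar ∧
      ∀ π : Measure (X × Y), IsCoupling μ ν π →
        EOT c ε μ ν πstar ≤ EOT c ε μ ν π := by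
  have hc : Measurable c := hc_lsc.measurable
  set K := couplingDensities μ ν
  have hEOT : ∀ f ∈ K, EOT c ε μ ν (densityMeasure f) = (densityEnergy (μ.prod ν) c ε f : EReal) :=
    fun f hf => EOT_densityMeasure hc hc_nonneg hc_bdd hε hf
  obtain ⟨f, hfK, hfin, hmin⟩ := exists_unique_minimizer_of_midpoint_le
    (K := K) (J := fun f => densityEnergy (μ.prod ν) c ε f)
    (fun t => isClosed_couplingDensities.inter (isClosed_densityEnergy_le hc t))
    (by
      obtain ⟨f, hf, hfeq⟩ :=
        (isCoupling_prod (μ := μ) (ν := ν)).exists_density Measure.AbsolutelyContinuous.rfl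
      refine ⟨f, hf, fun htop => ?_⟩
      have h := hEOT f hf
      rw [hfeq, htop, EReal.coe_ennreal_top] at h
      exact EOT_prod_lt_top.ne h)
    (k := ε / 8) (by positivity)
    (fun f hf g hg => ⟨_, midpoint_mem_couplingDensities hf hg,
      densityEnergy_midpoint_le hc hc_nonneg hε hf.1 hg.1
        (integral_eq_one_of_mem_couplingDensities hf)
        (integral_eq_one_of_mem_couplingDensities hg)⟩)
  refine ⟨densityMeasure f, ⟨isCoupling_densityMeasure hfK, fun π hπ => ?_⟩, ?_⟩
  · by_cases hac : π ≪ μ.prod ν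
    · obtain ⟨g, hg, rfl⟩ := hπ.exists_density hac
      rw [hEOT f hfK, hEOT g hg]
      exact EReal.coe_ennreal_le_coe_ennreal_iff.2 (hmin g hg).1
    · rw [EOT_eq_top hε hac]
      exact le_top
  · rintro π ⟨hπ, hπmin⟩
    have hle := hπmin _ (isCoupling_densityMeasure hfK)
    by_cases hac : π ≪ μ.prod ν
    · obtain ⟨g, hg, rfl⟩ := hπ.exists_density hac
      rw [hEOT f hfK, hEOT g hg, EReal.coe_ennreal_le_coe_ennreal_iff] at hle
      rw [(hmin g hg).2 hle]
    · rw [EOT_eq_top hε hac, hEOT f hfK, top_le_iff, EReal.coe_ennreal_eq_top_iff] at hle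
      exact absurd hle hfin
end
end

section
/- Suppose π ∈ Π(μ,ν) satisfies π = exp((α(x)+β(y)−c(x,y))/ε)·(μ⊗ν) = exp((α'(x)+β'(y)−c(x,y))/ε)·(μ⊗ν) for measurable functions α,α': X→ℝ and β,β': Y→ℝ. Then there exists a constant C∈ℝ such that α' = α + C μ-almost everywhere and β' = β − C ν-almost everywhere; i.e. the entropic potentials are unique μ-a.e. and ν-a.e. up to a constant offset. -/
open MeasureTheory Filter Topology
open scoped ENNReal

noncomputable section

/-- entropic potentials are unique (μ-a.e. and ν-a.e.) up to a constant offset. -/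
theorem entropic_potentials_unique_up_to_constant
    {X Y : Type*} [MetricSpace X] [CompactSpace X] [MeasurableSpace X] [BorelSpace X]
    [MetricSpace Y] [CompactSpace Y] [MeasurableSpace Y] [BorelSpace Y]
    (μ : Measure X) (ν : Measure Y) [IsProbabilityMeasure μ] [IsProbabilityMeasure ν]
    (c : X × Y → ℝ) (hc_lsc : LowerSemicontinuous c) (hc_nonneg : ∀ p, 0 ≤ c p)
    (M : ℝ) (hc_bdd : ∀ p, c p ≤ M) (ε : ℝ) (hε : 0 < ε)
    (π : Measure (X × Y)) (hπ : IsCoupling μ ν π)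
    (α α' : X → ℝ) (β β' : Y → ℝ)
    (hα : Measurable α) (hα' : Measurable α') (hβ : Measurable β) (hβ' : Measurable β')
    (h1 : π = (μ.prod ν).withDensity
      (fun p => ENNReal.ofReal (Real.exp ((α p.1 + β p.2 - c p) / ε))))
    (h2 : π = (μ.prod ν).withDensity
      (fun p => ENNReal.ofReal (Real.exp ((α' p.1 + β' p.2 - c p) / ε)))) :
    ∃ C : ℝ, (∀ᵐ x ∂μ, α' x = α x + C) ∧ (∀ᵐ y ∂ν, β' y = β y - C) := by
  have hcm : Measurable c := hc_lsc.measurable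
  have hdens := (withDensity_eq_iff_of_sigmaFinite (by fun_prop) (by fun_prop)).mp
    (h1.symm.trans h2)
  have hsum : ∀ᵐ p ∂(μ.prod ν), α p.1 + β p.2 = α' p.1 + β' p.2 := by
    filter_upwards [hdens] with p hp
    rw [ENNReal.ofReal_eq_ofReal_iff (Real.exp_pos _).le (Real.exp_pos _).le,
      Real.exp_eq_exp, div_left_inj' hε.ne'] at hp
    linarith
  have hsections := Measure.ae_ae_of_ae_prod hsum
  obtain ⟨x₀, hx₀⟩ := hsections.exists
  refine ⟨α' x₀ - α x₀, ?_, ?_⟩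
  · filter_upwards [hsections] with x hx
    obtain ⟨y, hy, hy₀⟩ := (hx.and hx₀).exists
    linarith
  · filter_upwards [hx₀] with y hy
    linarith
end
end

section
/- Let Z be a compact metric space, let (ρ_n)_n be a sequence of nonnegative finite Radon measures on Z converging weak* to ρ, let A ⊆ Z be closed, and assume ρ(A) = lim_{n→∞} ρ_n(A). Then the restrictions ρ_n⌊A converge weak* to ρ⌊A. -/
open MeasureTheory Filter Topology
open scoped ENNReal

/-- If `χ ≥ 0` is continuous and equals `1` on `A`, multiplying by `χ` approximates restriction to
`A` up to `C` times the excess mass of `χ`, for functions bounded by `C`. -/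
lemma abs_setIntegral_sub_integral_mul_le {Z : Type*} [TopologicalSpace Z] [CompactSpace Z]
    [MeasurableSpace Z] [OpensMeasurableSpace Z] (μ : Measure Z) [IsFiniteMeasure μ]
    {A : Set Z} (hA : MeasurableSet A) {f χ : Z → ℝ} (hf : Continuous f) (hχ : Continuous χ)
    (hnonneg : ∀ z, 0 ≤ χ z) (heq : ∀ z ∈ A, χ z = 1) {C : ℝ} (hC : ∀ z, |f z| ≤ C) :
    |∫ z in A, f z ∂μ - ∫ z, f z * χ z ∂μ| ≤ C * (∫ z, χ z ∂μ - μ.real A) := by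
  have hint {g : Z → ℝ} (hg : Continuous g) : Integrable g μ :=
    hg.integrable_of_hasCompactSupport (HasCompactSupport.of_compactSpace g)
  have h1 : Integrable (A.indicator (1 : Z → ℝ)) μ :=
    (integrable_const (1 : ℝ)).indicator hA
  rw [← integral_indicator_one hA, ← integral_indicator hA,
    ← integral_sub ((hint hf).indicator hA) (hint (hf.fun_mul hχ)), ← integral_sub (hint hχ) h1,
    ← integral_const_mul, ← Real.norm_eq_abs]
  refine norm_integral_le_of_norm_le (((hint hχ).sub h1).const_mul C) (ae_of_all _ fun z => ?_)
  by_cases hz : z ∈ A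
  · simp [hz, heq z hz]
  · simpa [hz, abs_mul, abs_of_nonneg (hnonneg z)] using
      mul_le_mul_of_nonneg_right (hC z) (hnonneg z)

/-- continuity of the restriction operator: if `ρ_n → ρ` weak*, `A` is closed
and `ρ_n(A) → ρ(A)`, then `ρ_n⌊A → ρ⌊A` weak*. -/
theorem restriction_weakstar_continuous
    {Z : Type*} [MetricSpace Z] [CompactSpace Z] [MeasurableSpace Z] [BorelSpace Z]
    (ρn : ℕ → Measure Z) (ρ : Measure Z)
    [∀ n, IsFiniteMeasure (ρn n)] [IsFiniteMeasure ρ]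
    (hweak : ∀ f : Z → ℝ, Continuous f →
      Tendsto (fun n => ∫ z, f z ∂(ρn n)) atTop (𝓝 (∫ z, f z ∂ρ)))
    (A : Set Z) (hA : IsClosed A)
    (hlim : Tendsto (fun n => ρn n A) atTop (𝓝 (ρ A))) :
    ∀ f : Z → ℝ, Continuous f →
      Tendsto (fun n => ∫ z, f z ∂((ρn n).restrict A)) atTop
        (𝓝 (∫ z, f z ∂(ρ.restrict A))) := by
  intro f hf
  obtain ⟨C, hC⟩ : ∃ C, ∀ z, |f z| ≤ C := by
    obtain ⟨C, hC⟩ := isCompact_univ.exists_bound_of_continuousOn hf.continuousOn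
    exact ⟨C, fun z => hC z trivial⟩
  let χ : ℕ → Z → ℝ := fun k z => hA.apprSeq k z
  have hχ (k : ℕ) : Continuous (χ k) := NNReal.continuous_coe.comp (hA.apprSeq k).continuous
  have heq (k : ℕ) (z : Z) (hz : z ∈ A) : χ k z = 1 := by
    simp [χ, HasOuterApproxClosed.apprSeq_apply_eq_one hA k hz]
  have hreal : Tendsto (fun n => (ρn n).real A) atTop (𝓝 (ρ.real A)) :=
    (ENNReal.tendsto_toReal (measure_ne_top ρ A)).comp hlim
  have hχlim : Tendsto (fun k => ∫ z, χ k z ∂ρ) atTop (𝓝 (ρ.real A)) := by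
    rw [← integral_indicator_one hA.measurableSet]
    refine tendsto_integral_of_dominated_convergence (fun _ => 1)
      (fun k => (hχ k).aestronglyMeasurable) (integrable_const _)
      (fun k => ae_of_all _ fun z => ?_) (ae_of_all _ fun z => ?_)
    · simpa [χ] using HasOuterApproxClosed.apprSeq_apply_le_one hA k z
    · have h := (NNReal.continuous_coe.tendsto _).comp
        (tendsto_pi_nhds.mp (HasOuterApproxClosed.tendsto_apprSeq hA) z)
      by_cases hz : z ∈ A <;> simpa [hz, χ, Function.comp_def] using h
  have hexcess : Tendsto (fun k => C * (∫ z, χ k z ∂ρ - ρ.real A)) atTop (𝓝 0) := by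
    simpa using (hχlim.sub_const (ρ.real A)).const_mul C
  rw [Metric.tendsto_nhds]
  intro ε hε
  obtain ⟨k, hk⟩ := (hexcess.eventually_lt_const (show (0 : ℝ) < ε / 3 by positivity)).exists
  have hn : Tendsto (fun n => C * (∫ z, χ k z ∂(ρn n) - (ρn n).real A)) atTop
      (𝓝 (C * (∫ z, χ k z ∂ρ - ρ.real A))) := ((hweak _ (hχ k)).sub hreal).const_mul C
  filter_upwards [hn.eventually_lt_const hk, Metric.tendsto_nhds.mp
    (hweak _ (hf.fun_mul (hχ k))) (ε / 3) (by positivity)] with n hn hfn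
  have hbound (μ : Measure Z) [IsFiniteMeasure μ] := abs_setIntegral_sub_integral_mul_le μ
    hA.measurableSet hf (hχ k) (fun z => (hA.apprSeq k z).coe_nonneg) (heq k) hC
  have h1 := abs_le.mp (hbound (ρn n))
  have h2 := abs_le.mp (hbound ρ)
  rw [Real.dist_eq, abs_lt] at hfn ⊢
  constructor <;> linarith [h1.1, h1.2, h2.1, h2.2, hfn.1, hfn.2]
end

section
/- Let w be a mass-preserving flow, (π̂_{ij}) a family of edge candidates with π̂_{ii}=π_i/m_i, and π̂ := Σ_{j∈I} Σ_{i∈𝒩(j)} w_{ij}·π̂_{ij}. Then the change in the transport objective satisfies ⟨c, π̂⟩ − ⟨c, π⟩ = Σ_{(i,j)∈𝒩} w_{ij}·c̄_{ij}, where c̄_{ij} := ⟨c, π̂_{ij} − π̂_{ii}⟩ are the edge cost coefficients. -/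
open MeasureTheory Filter Topology
open scoped ENNReal

noncomputable section

/-- A coupling has the total mass of its first marginal. -/
theorem IsCoupling.isFiniteMeasure {X Y : Type*} [MeasurableSpace X] [MeasurableSpace Y]
    {μ : Measure X} {ν : Measure Y} {π : Measure (X × Y)} (h : IsCoupling μ ν π)
    [IsFiniteMeasure μ] : IsFiniteMeasure π := by
  refine ⟨?_⟩
  have hπ : π Set.univ = μ Set.univ := by
    rw [← h.1, Measure.map_apply measurable_fst MeasurableSet.univ, Set.preimage_univ]
  rw [hπ]
  exact measure_lt_top μ _

/-- The integral against a coupling splits along a partition, up to null sets, of the first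
factor. -/
theorem IsCoupling.integral_eq_sum_setIntegral {X Y I : Type*} [MeasurableSpace X]
    [MeasurableSpace Y] [Fintype I] {μ : Measure X} {ν : Measure Y} {π : Measure (X × Y)}
    (h : IsCoupling μ ν π) {A : I → Set X} (hA : ∀ i, MeasurableSet (A i))
    (hcover : ⋃ i, A i = Set.univ) (hdisj : ∀ i j, i ≠ j → μ (A i ∩ A j) = 0)
    {c : X × Y → ℝ} (hc : Integrable c π) :
    ∫ p, c p ∂π = ∑ i, ∫ p in A i ×ˢ Set.univ, c p ∂π := by
  have hU : ⋃ i, A i ×ˢ (Set.univ : Set Y) = Set.univ := by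
    rw [← Set.iUnion_prod_const, hcover, Set.univ_prod_univ]
  rw [← tsum_fintype (L := .unconditional I), ← integral_iUnion_ae
    (fun i => ((hA i).prod MeasurableSet.univ).nullMeasurableSet) _ hc.integrableOn, hU,
    setIntegral_univ]
  intro i j hij
  have hij' := hdisj i j hij
  rw [← h.1, Measure.map_apply measurable_fst ((hA i).inter (hA j))] at hij'
  simpa [Function.onFun, AEDisjoint, Set.prod_univ] using hij'

/-- the change of the transport objective under a flow update equals
`Σ_{(i,j)∈𝒩} w_{ij}·c̄_{ij}` with `c̄_{ij} = ⟨c, π̂_{ij} − π̂_{ii}⟩`. -/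
theorem flow_update_cost_change
    {X Y : Type*} [MetricSpace X] [CompactSpace X] [MeasurableSpace X] [BorelSpace X]
    [MetricSpace Y] [CompactSpace Y] [MeasurableSpace Y] [BorelSpace Y]
    {I : Type*} [Fintype I] [DecidableEq I]
    (μ : Measure X) (ν : Measure Y) [IsProbabilityMeasure μ] [IsProbabilityMeasure ν]
    (c : X × Y → ℝ) (hc_meas : Measurable c) (M : ℝ) (hc_bdd : ∀ p, |c p| ≤ M)
    (π : Measure (X × Y)) (hπ : IsCoupling μ ν π)
    (Xpart : I → Set X) (hclosed : ∀ i, IsClosed (Xpart i))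
    (hcover : ⋃ i, Xpart i = Set.univ)
    (hdisj : ∀ i j, i ≠ j → μ (Xpart i ∩ Xpart j) = 0)
    (hm : ∀ i, 0 < μ (Xpart i))
    (N : Finset (I × I)) (hNrefl : ∀ i, (i, i) ∈ N)
    (hNsymm : ∀ i j, (i, j) ∈ N → (j, i) ∈ N)
    (w : I → I → ℝ) (hw_nonneg : ∀ i j, 0 ≤ w i j)
    (hw_supp : ∀ i j, (i, j) ∉ N → w i j = 0)
    (hdiv_out : ∀ i, ∑ j, w i j = (μ (Xpart i)).toReal)
    (hdiv_in : ∀ i, ∑ j, w j i = (μ (Xpart i)).toReal)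
    (πhat : I → I → Measure (X × Y))
    (hπhat : ∀ i j, (i, j) ∈ N →
      IsCoupling ((μ (Xpart j))⁻¹ • μ.restrict (Xpart j))
        ((μ (Xpart i))⁻¹ • (π.restrict (Xpart i ×ˢ Set.univ)).map Prod.snd)
        (πhat i j))
    (hπhat_diag : ∀ i, πhat i i = (μ (Xpart i))⁻¹ • π.restrict (Xpart i ×ˢ Set.univ)) :
    (∫ p, c p ∂(∑ e ∈ N, ENNReal.ofReal (w e.1 e.2) • πhat e.1 e.2)) - ∫ p, c p ∂π =
      ∑ e ∈ N, w e.1 e.2 *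
        ((∫ p, c p ∂(πhat e.1 e.2)) - ∫ p, c p ∂(πhat e.1 e.1)) := by
  have hA i : MeasurableSet (Xpart i) := (hclosed i).measurableSet
  have hint (ρ : Measure (X × Y)) [IsFiniteMeasure ρ] : Integrable c ρ :=
    .of_bound hc_meas.aestronglyMeasurable M (.of_forall hc_bdd)
  have hint_hat : ∀ e ∈ N, Integrable c (πhat e.1 e.2) := fun e he => by
    have : IsFiniteMeasure ((μ (Xpart e.2))⁻¹ • μ.restrict (Xpart e.2)) :=
      Measure.smul_finite _ (ENNReal.inv_ne_top.2 (hm e.2).ne')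
    have := (hπhat e.1 e.2 he).isFiniteMeasure
    exact hint _
  have hm_real i : (μ (Xpart i)).toReal ≠ 0 :=
    (ENNReal.toReal_pos (hm i).ne' (measure_ne_top _ _)).ne'
  have hdiag i : (μ (Xpart i)).toReal * ∫ p, c p ∂(πhat i i) =
      ∫ p in Xpart i ×ˢ Set.univ, c p ∂π := by
    rw [hπhat_diag, integral_smul_measure, ENNReal.toReal_inv, smul_eq_mul,
      mul_inv_cancel_left₀ (hm_real i)]
  have hstay : ∑ e ∈ N, w e.1 e.2 * ∫ p, c p ∂(πhat e.1 e.1) = ∫ p, c p ∂π := by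
    have := hπ.isFiniteMeasure
    rw [hπ.integral_eq_sum_setIntegral hA hcover hdisj (hint π)]
    calc ∑ e ∈ N, w e.1 e.2 * ∫ p, c p ∂(πhat e.1 e.1)
        = ∑ e : I × I, w e.1 e.2 * ∫ p, c p ∂(πhat e.1 e.1) :=
          Finset.sum_subset (Finset.subset_univ N) fun e _ he => by
            rw [hw_supp e.1 e.2 he, zero_mul]
      _ = ∑ i, ∫ p in Xpart i ×ˢ Set.univ, c p ∂π := by
          rw [Fintype.sum_prod_type]
          refine Finset.sum_congr rfl fun i _ => ?_
          rw [← hdiag i, ← hdiv_out i, Finset.sum_mul]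
  rw [integral_finsetSum_measure fun e he => (hint_hat e he).smul_measure ENNReal.ofReal_ne_top,
    ← hstay, ← Finset.sum_sub_distrib]
  refine Finset.sum_congr rfl fun e _ => ?_
  rw [integral_smul_measure, ENNReal.toReal_ofReal (hw_nonneg _ _), smul_eq_mul, mul_sub]
end
end

section
/- Let π̂_{ij} be the gluing edge candidate built from γ_{ij} ∈ Π(μ_i/m_i, μ_j/m_j) and π_i. If π_i ≪ μ_i⊗ν, then π̂_{ij} ≪ μ_j⊗ν, and its density is given μ_j⊗ν-almost everywhere by (dπ̂_{ij}/d(μ_j⊗ν))(x,y) = (1/m_j) ∫_{X_i} (dπ_i/d(μ_i⊗ν))(x',y) d(γ_{ij})_x(x'), where (γ_{ij})_x denotes the disintegration of γ_{ij} with respect to its μ_j/m_j-marginal at x. -/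
open MeasureTheory Filter Topology
open scoped ENNReal

noncomputable section

open ProbabilityTheory

lemma lintegral_bind_prod {X Y Z : Type*} [MeasurableSpace X] [MeasurableSpace Y]
    [MeasurableSpace Z] (μ : Measure X) (κ : Kernel X Y) (η : Kernel X Z)
    [IsSFiniteKernel κ] [IsSFiniteKernel η] {g : Y × Z → ℝ≥0∞} (hg : Measurable g) :
    ∫⁻ p, g p ∂(μ.bind fun x => (κ x).prod (η x))
      = ∫⁻ x, ∫⁻ y, ∫⁻ z, g (y, z) ∂η x ∂κ x ∂μ := by
  have h : (fun x => (κ x).prod (η x)) = ⇑(κ ×ₖ η) := by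
    ext1 x; rw [Kernel.prod_apply]
  rw [h, Measure.lintegral_bind (κ ×ₖ η).aemeasurable hg.aemeasurable]
  simp_rw [Kernel.prod_apply]
  exact lintegral_congr fun x => lintegral_prod _ hg.aemeasurable

lemma lintegral_bind_dirac_prod {X Z : Type*} [MeasurableSpace X] [MeasurableSpace Z]
    (μ : Measure X) (η : Kernel X Z) [IsSFiniteKernel η] {g : X × Z → ℝ≥0∞} (hg : Measurable g) :
    ∫⁻ p, g p ∂(μ.bind fun x => (Measure.dirac x).prod (η x))
      = ∫⁻ x, ∫⁻ z, g (x, z) ∂η x ∂μ := by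
  have h := lintegral_bind_prod μ Kernel.id η hg
  simp only [Kernel.id_apply] at h
  rw [h]
  exact lintegral_congr fun x => lintegral_dirac' x hg.lintegral_prod_right'

lemma lintegral_bind_prod_dirac {X Y : Type*} [MeasurableSpace X] [MeasurableSpace Y]
    (μ : Measure X) (κ : Kernel X Y) [IsSFiniteKernel κ] {g : Y × X → ℝ≥0∞} (hg : Measurable g) :
    ∫⁻ p, g p ∂(μ.bind fun x => (κ x).prod (Measure.dirac x))
      = ∫⁻ x, ∫⁻ y, g (y, x) ∂κ x ∂μ := by
  have h := lintegral_bind_prod μ κ Kernel.id hg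
  simp only [Kernel.id_apply] at h
  rw [h]
  exact lintegral_congr fun x => lintegral_congr fun y =>
    lintegral_dirac' x (hg.comp measurable_prodMk_left)

/-- Gluing two plans along their common first marginal: if `κ` and `κ'` are the two
disintegrations of one plan, and the plan with disintegration `η` has density `f` with respect
to a product measure, then the glued plan has density `c₂ * ∫ f (x, y) dκ'ᵤ(x)` at `(u, y)`. -/
lemma smul_bind_prod_eq_withDensity {X U Y : Type*} [MeasurableSpace X] [MeasurableSpace U]
    [MeasurableSpace Y] {μ₁ : Measure X} {μ₂ : Measure U} {ν : Measure Y}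
    [SFinite μ₁] [SFinite μ₂] [SFinite ν] {κ : Kernel X U} {κ' : Kernel U X} {η : Kernel X Y}
    [IsSFiniteKernel κ] [IsSFiniteKernel κ'] [IsSFiniteKernel η] {c₁ c₂ : ℝ≥0∞}
    {f : X × Y → ℝ≥0∞} (hf : Measurable f)
    (hκ : (c₁ • μ₁).bind (fun x => (Measure.dirac x).prod (κ x))
      = (c₂ • μ₂).bind (fun u => (κ' u).prod (Measure.dirac u)))
    (hη : μ₁.bind (fun x => (Measure.dirac x).prod (η x)) = (μ₁.prod ν).withDensity f) :
    c₁ • μ₁.bind (fun x => (κ x).prod (η x))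
      = (μ₂.prod ν).withDensity fun p => c₂ * ∫⁻ x, f (x, p.2) ∂κ' p.1 := by
  have hdens : Measurable fun p : U × Y => ∫⁻ x, f (x, p.2) ∂κ' p.1 :=
    Measurable.lintegral_kernel_prod_right (κ := Kernel.prodMkRight Y κ')
      (f := fun (p : U × Y) x => f (x, p.2)) (by fun_prop)
  refine Measure.ext_of_lintegral _ fun g hg => ?_
  have hG : Measurable fun p : X × Y => ∫⁻ u, g (u, p.2) ∂κ p.1 :=
    Measurable.lintegral_kernel_prod_right (κ := Kernel.prodMkRight Y κ)
      (f := fun (p : X × Y) u => g (u, p.2)) (by fun_prop)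
  have hF : Measurable fun p : X × U => ∫⁻ y, f (p.1, y) * g (p.2, y) ∂ν :=
    Measurable.lintegral_prod_right'
      (f := fun q : (X × U) × Y => f (q.1.1, q.2) * g (q.1.2, q.2)) (by fun_prop)
  have key : c₁ * ∫⁻ x, ∫⁻ u, ∫⁻ y, f (x, y) * g (u, y) ∂ν ∂κ x ∂μ₁
      = c₂ * ∫⁻ u, ∫⁻ x, ∫⁻ y, f (x, y) * g (u, y) ∂ν ∂κ' u ∂μ₂ := by
    have h := congrArg (fun ρ => ∫⁻ p, (∫⁻ y, f (p.1, y) * g (p.2, y) ∂ν) ∂ρ) hκ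
    simpa only [lintegral_bind_dirac_prod _ _ hF, lintegral_bind_prod_dirac _ _ hF,
      lintegral_smul_measure, smul_eq_mul] using h
  have hplan : ∫⁻ x, ∫⁻ y, ∫⁻ u, g (u, y) ∂κ x ∂η x ∂μ₁
      = ∫⁻ x, ∫⁻ y, f (x, y) * ∫⁻ u, g (u, y) ∂κ x ∂ν ∂μ₁ := by
    have h := congrArg (fun ρ => ∫⁻ p, (∫⁻ u, g (u, p.2) ∂κ p.1) ∂ρ) hη
    simp only [lintegral_bind_dirac_prod _ _ hG, lintegral_withDensity_eq_lintegral_mul _ hf hG] at h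
    rwa [lintegral_prod _ (hf.mul hG).aemeasurable] at h
  calc ∫⁻ p, g p ∂(c₁ • μ₁.bind fun x => (κ x).prod (η x))
      = c₁ * ∫⁻ x, ∫⁻ y, ∫⁻ u, g (u, y) ∂κ x ∂η x ∂μ₁ := by
        rw [lintegral_smul_measure, lintegral_bind_prod _ _ _ hg, smul_eq_mul]
        congr 1
        exact lintegral_congr fun x => lintegral_lintegral_swap hg.aemeasurable
    _ = c₁ * ∫⁻ x, ∫⁻ u, ∫⁻ y, f (x, y) * g (u, y) ∂ν ∂κ x ∂μ₁ := by
        rw [hplan]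
        congr 1
        refine lintegral_congr fun x => ?_
        rw [lintegral_lintegral_swap (by fun_prop)]
        exact lintegral_congr fun y => (lintegral_const_mul _ (by fun_prop)).symm
    _ = c₂ * ∫⁻ u, ∫⁻ x, ∫⁻ y, f (x, y) * g (u, y) ∂ν ∂κ' u ∂μ₂ := key
    _ = c₂ * ∫⁻ u, ∫⁻ y, (∫⁻ x, f (x, y) ∂κ' u) * g (u, y) ∂ν ∂μ₂ := by
        congr 1
        refine lintegral_congr fun u => ?_
        rw [lintegral_lintegral_swap (by fun_prop)]
        exact lintegral_congr fun y => lintegral_mul_const _ (by fun_prop)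
    _ = ∫⁻ p, g p ∂((μ₂.prod ν).withDensity fun p => c₂ * ∫⁻ x, f (x, p.2) ∂κ' p.1) := by
        rw [lintegral_withDensity_eq_lintegral_mul _ (hdens.const_mul _) hg]
        simp only [Pi.mul_apply, mul_assoc]
        rw [lintegral_const_mul _ (by fun_prop), lintegral_prod _ (by fun_prop)]

/-- if `π_i ≪ μ_i⊗ν` then the gluing edge candidate `π̂_{ij}` satisfies
`π̂_{ij} ≪ μ_j⊗ν` with density
`(dπ̂_{ij}/d(μ_j⊗ν))(x,y) = (1/m_j) ∫_{X_i} (dπ_i/d(μ_i⊗ν))(x',y) d(γ_{ij})_x(x')`,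
where `(γ_{ij})_x` is the disintegration of `γ_{ij}` w.r.t. its `μ_j/m_j`-marginal. -/
theorem gluing_edge_candidate_density
    {X Y : Type*} [MetricSpace X] [CompactSpace X] [MeasurableSpace X] [BorelSpace X]
    [MetricSpace Y] [CompactSpace Y] [MeasurableSpace Y] [BorelSpace Y]
    {I : Type*} [Fintype I] [DecidableEq I]
    (μ : Measure X) (ν : Measure Y) [IsProbabilityMeasure μ] [IsProbabilityMeasure ν]
    (π : Measure (X × Y)) (hπ : IsCoupling μ ν π)
    (Xpart : I → Set X) (hclosed : ∀ i, IsClosed (Xpart i))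
    (hcover : ⋃ i, Xpart i = Set.univ)
    (hdisj : ∀ i j, i ≠ j → μ (Xpart i ∩ Xpart j) = 0)
    (hm : ∀ i, 0 < μ (Xpart i))
    (i j : I) (hij : i ≠ j)
    (γij : Measure (X × X))
    (hγ_coupling : IsCoupling ((μ (Xpart i))⁻¹ • μ.restrict (Xpart i))
      ((μ (Xpart j))⁻¹ • μ.restrict (Xpart j)) γij)
    -- disintegration kernel of γ_{ij} with respect to its first (μ_i/m_i) marginal
    (γk : X → Measure X) (hγk_meas : Measurable γk)
    (hγk_prob : ∀ x, IsProbabilityMeasure (γk x))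
    (hγ_disint : γij = ((μ (Xpart i))⁻¹ • μ.restrict (Xpart i)).bind
      (fun x => (Measure.dirac x).prod (γk x)))
    -- disintegration kernel of γ_{ij} with respect to its second (μ_j/m_j) marginal
    (γk' : X → Measure X) (hγk'_meas : Measurable γk')
    (hγk'_prob : ∀ x, IsProbabilityMeasure (γk' x))
    (hγ_disint' : γij = ((μ (Xpart j))⁻¹ • μ.restrict (Xpart j)).bind
      (fun x => (γk' x).prod (Measure.dirac x)))
    -- disintegration kernel of π_i with respect to μ_i
    (πk : X → Measure Y) (hπk_meas : Measurable πk)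
    (hπk_prob : ∀ x, IsProbabilityMeasure (πk x))
    (hπ_disint : π.restrict (Xpart i ×ˢ Set.univ)
      = (μ.restrict (Xpart i)).bind (fun x => (Measure.dirac x).prod (πk x)))
    (habs : π.restrict (Xpart i ×ˢ Set.univ) ≪ (μ.restrict (Xpart i)).prod ν) :
    ((μ (Xpart i))⁻¹ • (μ.restrict (Xpart i)).bind (fun x => (γk x).prod (πk x))
        ≪ (μ.restrict (Xpart j)).prod ν) ∧
    (∀ᵐ p ∂((μ.restrict (Xpart j)).prod ν),
      ((μ (Xpart i))⁻¹ • (μ.restrict (Xpart i)).bind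
          (fun x => (γk x).prod (πk x))).rnDeriv ((μ.restrict (Xpart j)).prod ν) p
        = (μ (Xpart j))⁻¹ *
            ∫⁻ x', (π.restrict (Xpart i ×ˢ Set.univ)).rnDeriv
              ((μ.restrict (Xpart i)).prod ν) (x', p.2) ∂(γk' p.1)) := by
  have : IsFiniteMeasure π := by
    refine ⟨?_⟩
    have h : π.map Prod.fst Set.univ = 1 := by rw [hπ.1, measure_univ]
    rw [Measure.map_apply measurable_fst MeasurableSet.univ, Set.preimage_univ] at h
    simp [h]
  let κ : Kernel X X := ⟨γk, hγk_meas⟩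
  let κ' : Kernel X X := ⟨γk', hγk'_meas⟩
  let η : Kernel X Y := ⟨πk, hπk_meas⟩
  have : IsMarkovKernel κ := ⟨hγk_prob⟩
  have : IsMarkovKernel κ' := ⟨hγk'_prob⟩
  have : IsMarkovKernel η := ⟨hπk_prob⟩
  have hf := Measure.measurable_rnDeriv (π.restrict (Xpart i ×ˢ Set.univ))
    ((μ.restrict (Xpart i)).prod ν)
  have : (π.restrict (Xpart i ×ˢ Set.univ)).HaveLebesgueDecomposition
      ((μ.restrict (Xpart i)).prod ν) := by
    have : SigmaFinite ((μ.restrict (Xpart i)).prod ν) := inferInstance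
    have : SFinite (π.restrict (Xpart i ×ˢ Set.univ)) := inferInstance
    exact Measure.haveLebesgueDecomposition_of_sigmaFinite _ _
  have hdensπ := Measure.withDensity_rnDeriv_eq _ _ habs
  have h := smul_bind_prod_eq_withDensity (κ := κ) (κ' := κ') (η := η) hf
    (hγ_disint.symm.trans hγ_disint')
    (hπ_disint.symm.trans hdensπ.symm)
  have hdens : Measurable fun p : X × Y => ∫⁻ x, (π.restrict (Xpart i ×ˢ Set.univ)).rnDeriv
      ((μ.restrict (Xpart i)).prod ν) (x, p.2) ∂κ' p.1 :=
    Measurable.lintegral_kernel_prod_right (κ := Kernel.prodMkRight Y κ')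
      (f := fun (p : X × Y) x => (π.restrict (Xpart i ×ˢ Set.univ)).rnDeriv
        ((μ.restrict (Xpart i)).prod ν) (x, p.2)) (by fun_prop)
  change ((μ (Xpart i))⁻¹ • (μ.restrict (Xpart i)).bind (fun x => (κ x).prod (η x)) ≪ _) ∧
    ∀ᵐ p ∂_, ((μ (Xpart i))⁻¹ • (μ.restrict (Xpart i)).bind
      (fun x => (κ x).prod (η x))).rnDeriv _ p = _
  rw [h]
  exact ⟨withDensity_absolutelyContinuous _ _,
    Measure.rnDeriv_withDensity _ (hdens.const_mul _)⟩
end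
end

section
/- Let π̂_{ij} be the gluing edge candidate built from γ_{ij} ∈ Π(μ_i/m_i, μ_j/m_j) and π_i, and assume π_i ≪ μ_i⊗ν. Then KL(m_j·π̂_{ij} | μ_j⊗ν) ≤ (m_j/m_i)·KL(π_i | μ_i⊗ν). -/
open MeasureTheory Filter Topology
open scoped ENNReal

noncomputable section

open InformationTheory in
lemma KL_eq_klDiv {Z : Type*} [MeasurableSpace Z] (ρ σ : Measure Z)
    [IsFiniteMeasure ρ] [IsFiniteMeasure σ] : KL ρ σ = klDiv ρ σ := by
  rw [klDiv_eq_lintegral_klFun, KL]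
  have h (s : ℝ) : phiKL s = klFun s := by rw [phiKL, klFun_apply]; ring
  simp_rw [h]

open ProbabilityTheory in
/-- Pushing the first coordinate of `μ.bind (δₓ ⊗ η x)` through a Markov kernel `κ`. -/
lemma parallelComp_id_comp_bind_dirac_prod {X X' Y : Type*} [MeasurableSpace X]
    [MeasurableSpace X'] [MeasurableSpace Y] (μ : Measure X) (κ : Kernel X X') (η : Kernel X Y)
    [IsMarkovKernel κ] [IsMarkovKernel η] :
    (κ ∥ₖ (Kernel.id : Kernel Y Y)) ∘ₘ μ.bind (fun x => (Measure.dirac x).prod (η x)) =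
      μ.bind (fun x => (κ x).prod (η x)) := by
  have h₁ : (fun x => (Measure.dirac x).prod (η x)) =
      ((Kernel.id : Kernel X X) ×ₖ η) := by
    ext1 x; rw [Kernel.prod_apply, Kernel.id_apply]
  have h₂ : (fun x => (κ x).prod (η x)) = (κ ×ₖ η) := by
    ext1 x; rw [Kernel.prod_apply]
  rw [h₁, h₂, Measure.comp_assoc, Kernel.parallelComp_comp_prod, Kernel.comp_id, Kernel.id_comp]

open ProbabilityTheory in
lemma map_snd_bind_dirac_prod {X Y : Type*} [MeasurableSpace X] [MeasurableSpace Y]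
    (μ : Measure X) [SFinite μ] (η : Kernel X Y) [IsMarkovKernel η] :
    (μ.bind (fun x => (Measure.dirac x).prod (η x))).map Prod.snd = η ∘ₘ μ := by
  have h₁ : (fun x => (Measure.dirac x).prod (η x)) =
      ((Kernel.id : Kernel X X) ×ₖ η) := by
    ext1 x; rw [Kernel.prod_apply, Kernel.id_apply]
  rw [h₁, ← Measure.compProd_eq_comp_prod, ← Measure.snd, Measure.snd_compProd]

/-- for the gluing edge candidate `π̂_{ij}`, if `π_i ≪ μ_i⊗ν` then
`KL(m_j·π̂_{ij} | μ_j⊗ν) ≤ (m_j/m_i)·KL(π_i | μ_i⊗ν)`. -/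
theorem gluing_edge_candidate_KL_estimate
    {X Y : Type*} [MetricSpace X] [CompactSpace X] [MeasurableSpace X] [BorelSpace X]
    [MetricSpace Y] [CompactSpace Y] [MeasurableSpace Y] [BorelSpace Y]
    {I : Type*} [Fintype I] [DecidableEq I]
    (μ : Measure X) (ν : Measure Y) [IsProbabilityMeasure μ] [IsProbabilityMeasure ν]
    (π : Measure (X × Y)) (hπ : IsCoupling μ ν π)
    (Xpart : I → Set X) (hclosed : ∀ i, IsClosed (Xpart i))
    (hcover : ⋃ i, Xpart i = Set.univ)
    (hdisj : ∀ i j, i ≠ j → μ (Xpart i ∩ Xpart j) = 0)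
    (hm : ∀ i, 0 < μ (Xpart i))
    (i j : I) (hij : i ≠ j)
    (γij : Measure (X × X))
    (hγ_coupling : IsCoupling ((μ (Xpart i))⁻¹ • μ.restrict (Xpart i))
      ((μ (Xpart j))⁻¹ • μ.restrict (Xpart j)) γij)
    (γk : X → Measure X) (hγk_meas : Measurable γk)
    (hγk_prob : ∀ x, IsProbabilityMeasure (γk x))
    (hγ_disint : γij = ((μ (Xpart i))⁻¹ • μ.restrict (Xpart i)).bind
      (fun x => (Measure.dirac x).prod (γk x)))
    (πk : X → Measure Y) (hπk_meas : Measurable πk)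
    (hπk_prob : ∀ x, IsProbabilityMeasure (πk x))
    (hπ_disint : π.restrict (Xpart i ×ˢ Set.univ)
      = (μ.restrict (Xpart i)).bind (fun x => (Measure.dirac x).prod (πk x)))
    (habs : π.restrict (Xpart i ×ˢ Set.univ) ≪ (μ.restrict (Xpart i)).prod ν) :
    KL ((μ (Xpart j)) •
        ((μ (Xpart i))⁻¹ • (μ.restrict (Xpart i)).bind (fun x => (γk x).prod (πk x))))
        ((μ.restrict (Xpart j)).prod ν)
      ≤ ((μ (Xpart j)) / (μ (Xpart i))) *
          KL (π.restrict (Xpart i ×ˢ Set.univ)) ((μ.restrict (Xpart i)).prod ν) := by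
  let κ : ProbabilityTheory.Kernel X X := ⟨γk, hγk_meas⟩
  let η : ProbabilityTheory.Kernel X Y := ⟨πk, hπk_meas⟩
  have : ProbabilityTheory.IsMarkovKernel κ := ⟨hγk_prob⟩
  have : ProbabilityTheory.IsMarkovKernel η := ⟨hπk_prob⟩
  have hi0 : μ (Xpart i) ≠ 0 := (hm i).ne'
  have hj0 : μ (Xpart j) ≠ 0 := (hm j).ne'
  have hjtop : μ (Xpart j) ≠ ⊤ := measure_ne_top μ _
  set c : ℝ≥0∞ := μ (Xpart j) / μ (Xpart i) with hc
  have hctop : c ≠ ⊤ := ENNReal.div_ne_top hjtop hi0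
  have hπfin : IsFiniteMeasure π := by
    constructor
    rw [← Set.preimage_univ (f := Prod.fst), ← Measure.map_apply measurable_fst .univ, hπ.1]
    exact measure_lt_top _ _
  set K := κ.parallelComp (ProbabilityTheory.Kernel.id : ProbabilityTheory.Kernel Y Y)
  have hleft : (μ.restrict (Xpart i)).bind (fun x => (γk x).prod (πk x)) =
      (π.restrict (Xpart i ×ˢ Set.univ)).bind K := by
    rw [hπ_disint]
    exact (parallelComp_id_comp_bind_dirac_prod _ κ η).symm
  have hsnd : (μ (Xpart j))⁻¹ • μ.restrict (Xpart j) =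
      (μ (Xpart i))⁻¹ • (μ.restrict (Xpart i)).bind κ := by
    rw [← hγ_coupling.2, hγ_disint]
    refine (map_snd_bind_dirac_prod _ κ).trans ?_
    rw [Measure.comp_smul]
  have hright : (μ.restrict (Xpart j)).prod ν =
      c • ((μ.restrict (Xpart i)).prod ν).bind K := by
    have h : μ.restrict (Xpart j) = c • (μ.restrict (Xpart i)).bind κ := by
      rw [hc, div_eq_mul_inv, ← smul_smul, ← hsnd, smul_smul,
        ENNReal.mul_inv_cancel hj0 hjtop, one_smul]
    rw [← Measure.prod_comp_left, h, Measure.prod_smul_left]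
  rw [hleft, hright, smul_smul, ← div_eq_mul_inv, ← hc]
  clear_value c
  lift c to NNReal using hctop
  rw [Measure.coe_nnreal_smul, Measure.coe_nnreal_smul, KL_eq_klDiv, KL_eq_klDiv]
  refine (InformationTheory.klDiv_smul_same c).trans_le ?_
  gcongr
  exact InformationTheory.klDiv_comp_right_le _ _ K
end
end
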